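/- Let I ⊆ ℝ be an open interval containing 0, and let u : ℝ × ℝ → ℝ be smooth, spatially periodic, and satisfy the μBurgers equation u_txx + 3u_x u_xx + u u_xxx = 0 for all t ∈ I and x ∈ ℝ. Let η : I × ℝ → ℝ be smooth with ∂_t η(t,x) = u(t, η(t,x)) and η(0,x) = x (the flow of u). Then for all t ∈ I and all x ∈ ℝ, η(t,x) = x + t ( u(0,x) − u(0,0) ) + η(t,0). -/

import Mathlib

open intervalIntegral

/-- Partial derivative in the second (spatial) variable. -/
noncomputable def pdx (u : ℝ × ℝ → ℝ) : ℝ × ℝ → ℝ := fun p => deriv (fun y => u (p.1, y)) p.2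

/-- Partial derivative in the first (time) variable. -/
noncomputable def pdt (u : ℝ × ℝ → ℝ) : ℝ × ℝ → ℝ := fun p => deriv (fun s => u (s, p.2)) p.1

theorem pdx_eq_fderiv {u : ℝ × ℝ → ℝ} (hu : Differentiable ℝ u) :
    pdx u = fun p => fderiv ℝ u p (0, 1) := by
  funext p
  exact ((hu p).hasFDerivAt.comp_hasDerivAt p.2
    ((hasDerivAt_const p.2 p.1).prodMk (hasDerivAt_id p.2))).deriv

theorem pdt_eq_fderiv {u : ℝ × ℝ → ℝ} (hu : Differentiable ℝ u) :
    pdt u = fun p => fderiv ℝ u p (1, 0) := by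
  funext p
  exact ((hu p).hasFDerivAt.comp_hasDerivAt p.1
    ((hasDerivAt_id p.1).prodMk (hasDerivAt_const p.1 p.2))).deriv

theorem ContDiff.pdx {u : ℝ × ℝ → ℝ} (hu : ContDiff ℝ (⊤ : ℕ∞) u) :
    ContDiff ℝ (⊤ : ℕ∞) (pdx u) := by
  rw [pdx_eq_fderiv (hu.differentiable (by simp))]
  exact (hu.fderiv_right (m := (⊤ : ℕ∞)) (by simp)).clm_apply contDiff_const

theorem ContDiff.pdt {u : ℝ × ℝ → ℝ} (hu : ContDiff ℝ (⊤ : ℕ∞) u) :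
    ContDiff ℝ (⊤ : ℕ∞) (pdt u) := by
  rw [pdt_eq_fderiv (hu.differentiable (by simp))]
  exact (hu.fderiv_right (m := (⊤ : ℕ∞)) (by simp)).clm_apply contDiff_const

theorem ContDiff.hasDerivAt_pdx {u : ℝ × ℝ → ℝ} (hu : ContDiff ℝ (⊤ : ℕ∞) u) (t x : ℝ) :
    HasDerivAt (fun y => u (t, y)) (_root_.pdx u (t, x)) x := by
  have hd : Differentiable ℝ u := hu.differentiable (by simp)
  exact DifferentiableAt.hasDerivAt (f := fun y => u (t, y)) (by fun_prop)

/-- The chain rule along a curve `s ↦ (s, γ s)`. -/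
theorem ContDiff.hasDerivAt_along {u : ℝ × ℝ → ℝ} (hu : ContDiff ℝ (⊤ : ℕ∞) u)
    {γ : ℝ → ℝ} {v t : ℝ} (hγ : HasDerivAt γ v t) :
    HasDerivAt (fun s => u (s, γ s)) (_root_.pdt u (t, γ t) + v * _root_.pdx u (t, γ t)) t := by
  have hd : Differentiable ℝ u := hu.differentiable (by simp)
  have h := (hd (t, γ t)).hasFDerivAt.comp_hasDerivAt t ((hasDerivAt_id t).prodMk hγ)
  refine h.congr_deriv ?_
  have hv : ((1 : ℝ), v) = (1, 0) + v • (0, 1) := by simp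
  rw [pdt_eq_fderiv hd, pdx_eq_fderiv hd, hv, map_add, map_smul, smul_eq_mul]

/-- A function on a convex open set of reals with vanishing derivative there is constant. -/
theorem Convex.eq_of_hasDerivAt_zero {I : Set ℝ} (hI : Convex ℝ I) {f : ℝ → ℝ}
    (hf : ∀ t ∈ I, HasDerivAt f 0 t) {a b : ℝ} (ha : a ∈ I) (hb : b ∈ I) : f a = f b := by
  have h := hI.norm_image_sub_le_of_norm_hasDerivWithin_le (C := 0)
    (fun t ht => (hf t ht).hasDerivWithinAt) (by simp) hb ha
  simpa [sub_eq_zero] using h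

/-- A periodic function whose second derivative vanishes is constant. -/
theorem eq_of_periodic_of_second_deriv_zero {f f' : ℝ → ℝ} (hper : ∀ x, f (x + 1) = f x)
    (hf : ∀ x, HasDerivAt f (f' x) x) (hf' : ∀ x, HasDerivAt f' 0 x) (a b : ℝ) : f a = f b := by
  have hc : ∀ x, f' x = f' 0 := fun x =>
    convex_univ.eq_of_hasDerivAt_zero (fun t _ => hf' t) (Set.mem_univ x) (Set.mem_univ 0)
  have hg : ∀ x, f x - f' 0 * x = f 0 - f' 0 * 0 := fun x =>
    convex_univ.eq_of_hasDerivAt_zero (f := fun y => f y - f' 0 * y)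
      (fun t _ => ((hf t).sub ((hasDerivAt_id t).const_mul (f' 0))).congr_deriv (by simp [hc t]))
      (Set.mem_univ x) (Set.mem_univ 0)
  have h1 := hg 1
  have h2 := hper 0
  rw [zero_add] at h2
  have h0 : f' 0 = 0 := by linarith
  have hxa := hg a
  have hxb := hg b
  rw [h0] at hxa hxb
  linarith

/-- For a spatially periodic solution of the μBurgers equation, the Eulerian acceleration
`u_t + u u_x` does not depend on the spatial variable. -/
theorem muBurgers_acceleration_eq {u : ℝ × ℝ → ℝ} (hu : ContDiff ℝ (⊤ : ℕ∞) u)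
    (hper : ∀ t x, u (t, x + 1) = u (t, x)) {t : ℝ}
    (heq : ∀ x : ℝ,
      pdx (pdx (pdt u)) (t, x) + 3 * pdx u (t, x) * pdx (pdx u) (t, x)
        + u (t, x) * pdx (pdx (pdx u)) (t, x) = 0) (a b : ℝ) :
    pdt u (t, a) + u (t, a) * pdx u (t, a) = pdt u (t, b) + u (t, b) * pdx u (t, b) := by
  have hpx : ∀ x, pdx u (t, x + 1) = pdx u (t, x) := fun x => by
    have h : (fun y => u (t, y + 1)) = fun y => u (t, y) := funext (hper t)
    simp only [pdx]
    rw [← deriv_comp_add_const, h]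
  have hpt : ∀ x, pdt u (t, x + 1) = pdt u (t, x) := fun x => by
    simp only [pdt, hper]
  refine eq_of_periodic_of_second_deriv_zero
    (f := fun x => pdt u (t, x) + u (t, x) * pdx u (t, x))
    (f' := fun x => pdx (pdt u) (t, x)
      + (pdx u (t, x) * pdx u (t, x) + u (t, x) * pdx (pdx u) (t, x)))
    (fun x => by simp only [hpx, hpt, hper]) (fun x => ?_) (fun x => ?_) a b
  · exact (hu.pdt.hasDerivAt_pdx t x).add
      ((hu.hasDerivAt_pdx t x).mul (hu.pdx.hasDerivAt_pdx t x))
  · have hx := hu.pdx.hasDerivAt_pdx t x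
    refine ((hu.pdt.pdx.hasDerivAt_pdx t x).add ((hx.mul hx).add
      ((hu.hasDerivAt_pdx t x).mul (hu.pdx.pdx.hasDerivAt_pdx t x)))).congr_deriv ?_
    linear_combination heq x

/-- the flow η of a solution of the μBurgers equation has the explicit
form `η(t,x) = x + t(u₀(x) − u₀(0)) + η(t,0)`. -/
theorem muBurgers_flow_formula
    (I : Set ℝ) (hIopen : IsOpen I) (hIconv : Convex ℝ I) (h0I : (0:ℝ) ∈ I)
    (u : ℝ × ℝ → ℝ) (hu : ContDiff ℝ (⊤ : ℕ∞) u)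
    (hper : ∀ t x, u (t, x + 1) = u (t, x))
    (heq : ∀ t ∈ I, ∀ x : ℝ,
      pdx (pdx (pdt u)) (t, x) + 3 * pdx u (t, x) * pdx (pdx u) (t, x)
        + u (t, x) * pdx (pdx (pdx u)) (t, x) = 0)
    (η : ℝ × ℝ → ℝ) (hη : ContDiffOn ℝ (⊤ : ℕ∞) η (I ×ˢ (Set.univ : Set ℝ)))
    (hflow : ∀ t ∈ I, ∀ x : ℝ, pdt η (t, x) = u (t, η (t, x)))
    (hinit : ∀ x : ℝ, η (0, x) = x) :
    ∀ t ∈ I, ∀ x : ℝ, η (t, x) = x + t * (u (0, x) - u (0, 0)) + η (t, 0) := by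
  have hηt : ∀ t ∈ I, ∀ x, HasDerivAt (fun s => η (s, x)) (u (t, η (t, x))) t := by
    intro t ht x
    have hd : DifferentiableAt ℝ η (t, x) :=
      (hη.contDiffAt ((hIopen.prod isOpen_univ).mem_nhds ⟨ht, Set.mem_univ x⟩)).differentiableAt
        (by simp)
    have hs : DifferentiableAt ℝ (fun s => η (s, x)) t :=
      hd.comp t (by fun_prop : DifferentiableAt ℝ (fun s : ℝ => (s, x)) t)
    rw [← hflow t ht x]
    exact hs.hasDerivAt
  intro t ht x
  have hvel : ∀ s ∈ I, u (s, η (s, x)) - u (s, η (s, 0)) = u (0, x) - u (0, 0) := by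
    intro s hs
    have h := hIconv.eq_of_hasDerivAt_zero
      (f := fun r => u (r, η (r, x)) - u (r, η (r, 0)))
      (fun r hr => ((hu.hasDerivAt_along (hηt r hr x)).sub
        (hu.hasDerivAt_along (hηt r hr 0))).congr_deriv
          (sub_eq_zero.2 (muBurgers_acceleration_eq hu hper (heq r hr) _ _))) hs h0I
    simpa only [hinit] using h
  have h := hIconv.eq_of_hasDerivAt_zero
    (f := fun s => η (s, x) - η (s, 0) - s * (u (0, x) - u (0, 0)))
    (fun s hs => (((hηt s hs x).sub (hηt s hs 0)).sub
      ((hasDerivAt_id s).mul_const (u (0, x) - u (0, 0)))).congr_deriv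
        (by rw [hvel s hs]; ring)) ht h0I
  simp only [hinit] at h
  linarith
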